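/- Let p be stable of degree (n,m). In L²(dσ/|p|²), the reproducing kernel of the closed span of {z^i w^j : i,j ≥ 0, and (i<n or j<m)} is [p(z,w) conj(p(z₁,w₁)) − p̃(z,w) conj(p̃(z₁,w₁))] / [(1 − z z̄₁)(1 − w w̄₁)]. -/

import Mathlib

open Complex MeasureTheory Finset
open scoped ComplexInnerProductSpace

noncomputable section

/-- Evaluation of a bivariate polynomial with coefficient array `c i j`,
supported on `0 ≤ i ≤ n`, `0 ≤ j ≤ m`. -/
def evalP (n m : ℕ) (c : ℕ → ℕ → ℂ) (z w : ℂ) : ℂ :=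
  ∑ i ∈ Finset.range (n + 1), ∑ j ∈ Finset.range (m + 1), c i j * z ^ i * w ^ j

/-- `p` is stable: nonvanishing on the closed bidisk. -/
def Stable (n m : ℕ) (c : ℕ → ℕ → ℂ) : Prop :=
  ∀ z w : ℂ, ‖z‖ ≤ 1 → ‖w‖ ≤ 1 → evalP n m c z w ≠ 0

/-- `p` has degree exactly `n` in `z` and `m` in `w`. -/
def DegreeNM (n m : ℕ) (c : ℕ → ℕ → ℂ) : Prop :=
  (∃ j, c n j ≠ 0) ∧ (∃ i, c i m ≠ 0)

/-- Coefficients of the reflected polynomial `p̃(z,w) = zⁿ wᵐ conj (p (1/z̄, 1/w̄))`. -/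
def reflC (n m : ℕ) (c : ℕ → ℕ → ℂ) : ℕ → ℕ → ℂ :=
  fun i j => star (c (n - i) (m - j))

/-- The Laurent monomial `z^i w^j` as a function on the torus, `z = e^{iθ}`, `w = e^{iφ}`. -/
def tmono (i j : ℤ) : ℝ → ℝ → ℂ :=
  fun θ φ => Complex.exp (((i : ℂ) * (θ : ℂ) + (j : ℂ) * (φ : ℂ)) * Complex.I)

/-- A bivariate polynomial as a function on the torus. -/
def onT (n m : ℕ) (c : ℕ → ℕ → ℂ) : ℝ → ℝ → ℂ :=
  fun θ φ => evalP n m c (Complex.exp ((θ : ℂ) * Complex.I)) (Complex.exp ((φ : ℂ) * Complex.I))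

/-- The inner product `⟨f,g⟩ = ∫_{𝕋²} f ḡ dσ/|p|²` of `L²(dσ/|p|²)`. -/
def ip (n m : ℕ) (c : ℕ → ℕ → ℂ) (f g : ℝ → ℝ → ℂ) : ℂ :=
  (1 / (2 * Real.pi) ^ 2 : ℂ) *
    ∫ θ in (0 : ℝ)..(2 * Real.pi), ∫ φ in (0 : ℝ)..(2 * Real.pi),
      f θ φ * star (g θ φ) / ((Complex.normSq (onT n m c θ φ) : ℝ) : ℂ)

/-- Numerator of the Christoffel–Darboux-type kernel `L`:
`zⁿ (p(z,w) conj(p(1/z̄,η)) − p̃(z,w) conj(p̃(1/z̄,η)))`. -/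
def Lnum (n m : ℕ) (c : ℕ → ℕ → ℂ) (z w η : ℂ) : ℂ :=
  z ^ n * (evalP n m c z w * star (evalP n m c (star z)⁻¹ η)
    - evalP n m (reflC n m c) z w * star (evalP n m (reflC n m c) (star z)⁻¹ η))

/-- The kernel built from coefficient arrays `a k` for the polynomials `a_k(z,w)`:
`L(z,w;η) = Σ_{k<m} a_k(z,w) η̄^k`. -/
def Lsum (n m : ℕ) (a : ℕ → ℕ → ℕ → ℂ) (z w η : ℂ) : ℂ :=
  ∑ k ∈ Finset.range m, evalP (2 * n) (m - 1) (a k) z w * (star η) ^ k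

/-- `a` is the coefficient array of the kernel `L` associated with `p`:
`(1 - w η̄) L(z,w;η) = Lnum(z,w;η)` for all `z ≠ 0`. -/
def IsLCoeff (n m : ℕ) (c : ℕ → ℕ → ℂ) (a : ℕ → ℕ → ℕ → ℂ) : Prop :=
  ∀ z w η : ℂ, z ≠ 0 → (1 - w * star η) * Lsum n m a z w η = Lnum n m c z w η

/-- The measure `dμ = dσ/|p|²` on the torus, realized on the parameter square
`[0,2π]²` with normalized Lebesgue measure. -/
def muT (n m : ℕ) (c : ℕ → ℕ → ℂ) : Measure (ℝ × ℝ) :=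
  ((volume : Measure (ℝ × ℝ)).restrict
      (Set.Icc 0 (2 * Real.pi) ×ˢ Set.Icc 0 (2 * Real.pi))).withDensity
    fun x => ENNReal.ofReal
      (1 / ((2 * Real.pi) ^ 2 * Complex.normSq (onT n m c x.1 x.2)))

end

/-- The kernel [p(z,w) conj(p(z₁,w₁)) − p̃(z,w) conj(p̃(z₁,w₁))]/[(1−z z̄₁)(1−w w̄₁)]
as a function on the torus, z = e^{iθ}, w = e^{iφ}. -/
noncomputable def KHfun (n m : ℕ) (c : ℕ → ℕ → ℂ) (z₁ w₁ : ℂ) : ℝ × ℝ → ℂ :=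
  fun x =>
    (onT n m c x.1 x.2 * star (evalP n m c z₁ w₁)
      - onT n m (reflC n m c) x.1 x.2 * star (evalP n m (reflC n m c) z₁ w₁)) /
    ((1 - Complex.exp ((x.1 : ℂ) * Complex.I) * star z₁) *
      (1 - Complex.exp ((x.2 : ℂ) * Complex.I) * star w₁))

section helpers

theorem evalP_refl (n m : ℕ) (c : ℕ → ℕ → ℂ) (z w : ℂ) :
    evalP n m (reflC n m c) z w = ∑ i ∈ Finset.range (n + 1), ∑ j ∈ Finset.range (m + 1),
      star (c i j) * z ^ (n - i) * w ^ (m - j) := by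
  unfold evalP reflC
  rw [← Finset.sum_range_reflect]
  refine Finset.sum_congr rfl fun i hi => ?_
  rw [← Finset.sum_range_reflect]
  refine Finset.sum_congr rfl fun j hj => ?_
  have hi' : i ≤ n := by simpa [Nat.lt_succ_iff] using hi
  have hj' : j ≤ m := by simpa [Nat.lt_succ_iff] using hj
  have e1 : n + 1 - 1 - i = n - i := by omega
  have e2 : m + 1 - 1 - j = m - j := by omega
  have e3 : n - (n - i) = i := by omega
  have e4 : m - (m - j) = j := by omega
  rw [e1, e2, e3, e4]

theorem evalP_refl_refl (n m : ℕ) (c : ℕ → ℕ → ℂ) (z w : ℂ) :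
    evalP n m (reflC n m (reflC n m c)) z w = evalP n m c z w := by
  unfold evalP
  refine Finset.sum_congr rfl fun i hi => Finset.sum_congr rfl fun j hj => ?_
  have hi' : i ≤ n := by simpa [Nat.lt_succ_iff] using hi
  have hj' : j ≤ m := by simpa [Nat.lt_succ_iff] using hj
  have e3 : n - (n - i) = i := by omega
  have e4 : m - (m - j) = j := by omega
  simp [reflC, e3, e4]

theorem sum_refl (n m : ℕ) (c : ℕ → ℕ → ℂ) (z w : ℂ) :
    ∑ i ∈ Finset.range (n + 1), ∑ j ∈ Finset.range (m + 1),
      c i j * (star z) ^ (n - i) * (star w) ^ (m - j) = star (evalP n m (reflC n m c) z w) := by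
  rw [evalP_refl]
  simp

/-- the polynomial `p̃` on the torus -/
theorem evalP_refl_torus (n m : ℕ) (c : ℕ → ℕ → ℂ) (z w : ℂ) (hz : z * star z = 1)
    (hw : w * star w = 1) :
    evalP n m (reflC n m c) z w = z ^ n * w ^ m * star (evalP n m c z w) := by
  rw [evalP_refl]
  unfold evalP
  rw [star_sum, Finset.mul_sum]
  refine Finset.sum_congr rfl fun i hi => ?_
  rw [star_sum, Finset.mul_sum]
  refine Finset.sum_congr rfl fun j hj => ?_
  have hi' : i ≤ n := by simpa [Nat.lt_succ_iff] using hi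
  have hj' : j ≤ m := by simpa [Nat.lt_succ_iff] using hj
  have h1 : z ^ n * star z ^ i = z ^ (n - i) := by
    conv_lhs => rw [← Nat.sub_add_cancel hi', pow_add, mul_assoc, ← mul_pow, hz]
    simp
  have h2 : w ^ m * star w ^ j = w ^ (m - j) := by
    conv_lhs => rw [← Nat.sub_add_cancel hj', pow_add, mul_assoc, ← mul_pow, hw]
    simp
  rw [star_mul', star_mul', star_pow, star_pow, ← h1, ← h2]
  ring

section algebra
variable {R : Type*} [CommRing R] [Algebra ℂ R]

theorem split_geom (n a : ℕ) (ha : a ≤ n) (s : ℂ) (x Z : R) (hZ : Z * (1 - s • x) = 1) :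
    x ^ a * Z = ∑ k ∈ Finset.range (n - a), s ^ k • x ^ (a + k) + s ^ (n - a) • (x ^ n * Z) := by
  have h := geom_sum_mul_neg (s • x) (n - a)
  have h2 : Z = (∑ k ∈ Finset.range (n - a), (s • x) ^ k) + (s • x) ^ (n - a) * Z := by
    linear_combination (∑ k ∈ Finset.range (n - a), (s • x) ^ k) * hZ - Z * h
  conv_lhs => rw [h2, mul_add, Finset.mul_sum]
  congr 1
  · refine Finset.sum_congr rfl fun k _ => ?_
    rw [smul_pow, mul_smul_comm, pow_add]
  · rw [smul_pow, smul_mul_assoc, mul_smul_comm, ← mul_assoc, ← pow_add, Nat.add_sub_cancel' ha]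

theorem mem_alg (V : Submodule ℂ R) (n m : ℕ) (s t : ℂ) (x y Z W : R)
    (hZ : Z * (1 - s • x) = 1) (hW : W * (1 - t • y) = 1)
    (h1 : ∀ i b, i < n → x ^ i * (y ^ b * W) ∈ V) (h2 : ∀ j b, j < m → y ^ j * (x ^ b * Z) ∈ V)
    (N : ℕ → ℕ → ℂ)
    (hN : ∑ a ∈ Finset.range (n + 1), ∑ b ∈ Finset.range (m + 1),
      N a b * s ^ (n - a) * t ^ (m - b) = 0) :
    (∑ a ∈ Finset.range (n + 1), ∑ b ∈ Finset.range (m + 1), N a b • (x ^ a * y ^ b)) * Z * W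
      ∈ V := by
  have key : ∀ a ∈ Finset.range (n + 1), ∀ b ∈ Finset.range (m + 1),
      ∃ v ∈ V, (N a b • (x ^ a * y ^ b)) * Z * W
        = v + (N a b * s ^ (n - a) * t ^ (m - b)) • (x ^ n * Z * (y ^ m * W)) := by
    intro a ha b hb
    have ha' : a ≤ n := by simpa [Nat.lt_succ_iff] using ha
    have hb' : b ≤ m := by simpa [Nat.lt_succ_iff] using hb
    refine ⟨N a b • ((∑ k ∈ Finset.range (n - a), s ^ k • x ^ (a + k)) * (y ^ b * W)
      + s ^ (n - a) • ((∑ k ∈ Finset.range (m - b), t ^ k • y ^ (b + k)) * (x ^ n * Z))), ?_, ?_⟩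
    · refine V.smul_mem _ (V.add_mem ?_ (V.smul_mem _ ?_))
      · rw [Finset.sum_mul]
        refine V.sum_mem fun k hk => ?_
        rw [smul_mul_assoc]
        refine V.smul_mem _ (h1 _ _ ?_)
        have := Finset.mem_range.1 hk
        omega
      · rw [Finset.sum_mul]
        refine V.sum_mem fun k hk => ?_
        rw [smul_mul_assoc]
        refine V.smul_mem _ (h2 _ _ ?_)
        have := Finset.mem_range.1 hk
        omega
    · have e1 := split_geom n a ha' s x Z hZ
      have e2 := split_geom m b hb' t y W hW
      have e3 : (N a b • (x ^ a * y ^ b)) * Z * W = N a b • ((x ^ a * Z) * (y ^ b * W)) := by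
        rw [smul_mul_assoc, smul_mul_assoc]; congr 1; ring
      rw [e3, mul_assoc (N a b), mul_smul, ← smul_add]
      congr 1
      conv_lhs => rw [e1, add_mul]
      rw [add_assoc]
      congr 1
      rw [mul_smul, ← smul_add, smul_mul_assoc]
      congr 1
      rw [e2]
      rw [mul_add, mul_smul_comm, mul_comm]
  have : (∑ a ∈ Finset.range (n + 1), ∑ b ∈ Finset.range (m + 1), N a b • (x ^ a * y ^ b)) * Z * W
    - (∑ a ∈ Finset.range (n + 1), ∑ b ∈ Finset.range (m + 1),
      N a b * s ^ (n - a) * t ^ (m - b)) • (x ^ n * Z * (y ^ m * W)) ∈ V := by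
    simp only [Finset.sum_mul, Finset.sum_smul]
    rw [← Finset.sum_sub_distrib]
    refine V.sum_mem fun a ha => ?_
    rw [← Finset.sum_sub_distrib]
    refine V.sum_mem fun b hb => ?_
    obtain ⟨v, hv, e⟩ := key a ha b hb
    rw [e, add_sub_cancel_right]
    exact hv
  rwa [hN, zero_smul, sub_zero] at this

end algebra

theorem geom_mem {R : Type*} [NormedCommRing R] [NormedAlgebra ℂ R] [CompleteSpace R]
    (V : Submodule ℂ R) (hV : IsClosed (V : Set R)) (t : ℂ) (y u : R) (h : ‖t • y‖ < 1) (b : ℕ)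
    (hu : ∀ k, u * y ^ k ∈ V) : u * (y ^ b * ∑' k : ℕ, (t • y) ^ k) ∈ V := by
  have hs := ((summable_geometric_of_norm_lt_one h).hasSum.mul_left (y ^ b)).mul_left u
  refine hV.mem_of_tendsto hs (Filter.Eventually.of_forall fun S => ?_)
  refine V.sum_mem fun k _ => ?_
  rw [smul_pow, mul_smul_comm, mul_smul_comm, ← pow_add]
  exact V.smul_mem _ (hu _)

/-- Cauchy formula on the unit circle. -/
theorem cauchy_circle (h : ℂ → ℂ) (hh : DiffContOnCl ℂ h (Metric.ball 0 1)) (a : ℂ) (ha : ‖a‖ < 1) :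
    ∫ θ in (0 : ℝ)..(2 * Real.pi), h (Complex.exp ((θ : ℂ) * Complex.I)) /
      (1 - star (Complex.exp ((θ : ℂ) * Complex.I)) * a) = 2 * Real.pi * h a := by
  have h1 := hh.circleIntegral_sub_inv_smul (w := a) (by simpa using ha)
  rw [circleIntegral] at h1
  have h2 : ∀ θ : ℝ, deriv (circleMap 0 1) θ • ((circleMap 0 1 θ - a)⁻¹ • h (circleMap 0 1 θ))
      = Complex.I * (h (Complex.exp ((θ : ℂ) * Complex.I)) /
      (1 - star (Complex.exp ((θ : ℂ) * Complex.I)) * a)) := by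
    intro θ
    have e : circleMap 0 1 θ = Complex.exp ((θ : ℂ) * Complex.I) := by simp [circleMap]
    rw [deriv_circleMap, e]
    set E := Complex.exp ((θ : ℂ) * Complex.I) with hE
    have hn : ‖E‖ = 1 := Complex.norm_exp_ofReal_mul_I θ
    have hEE : E * star E = 1 := by
      rw [Complex.star_def, Complex.mul_conj, Complex.normSq_eq_norm_sq, hn]; simp
    have hne : E - a ≠ 0 := by
      intro h0
      rw [sub_eq_zero] at h0
      rw [← h0, hn] at ha
      exact lt_irrefl _ ha
    have hE0 : E ≠ 0 := by
      intro h0; rw [h0] at hn; simp at hn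
    have hfac : E * (1 - star E * a) = E - a := by linear_combination (-a) * hEE
    have hne2 : 1 - star E * a ≠ 0 := by
      intro h0; rw [h0, mul_zero] at hfac; exact hne hfac.symm
    rw [← hfac]
    simp only [smul_eq_mul]
    field_simp
    try simp [circleMap, hE]
  simp only [h2, intervalIntegral.integral_const_mul] at h1
  rw [smul_eq_mul] at h1
  have : Complex.I * (∫ θ in (0 : ℝ)..(2 * Real.pi), h (Complex.exp ((θ : ℂ) * Complex.I)) /
      (1 - star (Complex.exp ((θ : ℂ) * Complex.I)) * a)) = Complex.I * (2 * Real.pi * h a) := by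
    rw [h1]; ring
  exact mul_left_cancel₀ Complex.I_ne_zero this

theorem slice_dcc (h : ℂ → ℂ → ℂ)
    (hd : DifferentiableOn ℂ (fun q : ℂ × ℂ => h q.1 q.2) {q : ℂ × ℂ | ‖q.1‖ < 1 ∧ ‖q.2‖ < 1})
    (hc : ContinuousOn (fun q : ℂ × ℂ => h q.1 q.2) {q : ℂ × ℂ | ‖q.1‖ ≤ 1 ∧ ‖q.2‖ ≤ 1})
    (z : ℂ) (hz : ‖z‖ ≤ 1) : DiffContOnCl ℂ (fun w => h z w) (Metric.ball 0 1) := by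
  constructor
  · have hset : {q : ℂ × ℂ | ‖q.1‖ ≤ 1 ∧ ‖q.2‖ ≤ 1}
        = Metric.closedBall (0 : ℂ) 1 ×ˢ Metric.closedBall (0 : ℂ) 1 := by
      ext q; simp
    have hcomp : IsCompact (Metric.closedBall (0 : ℂ) 1 ×ˢ Metric.closedBall (0 : ℂ) 1) :=
      (isCompact_closedBall _ _).prod (isCompact_closedBall _ _)
    rw [hset] at hc
    have hu := hcomp.uniformContinuousOn_of_continuous hc
    have ht := UniformContinuousOn.tendstoUniformlyOn (F := h) (x := z) hu (by simpa using hz)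
    have hr : Filter.Tendsto (fun k : ℕ => ((1 - 1 / ((k : ℝ) + 1) : ℝ) : ℂ) * z) Filter.atTop
        (nhdsWithin z (Metric.closedBall 0 1)) := by
      rw [tendsto_nhdsWithin_iff]
      constructor
      · have h0 : Filter.Tendsto (fun k : ℕ => (1 - 1 / ((k : ℝ) + 1) : ℝ)) Filter.atTop (nhds 1) := by
          simpa using (tendsto_const_nhds (x := (1 : ℝ))).sub
            (tendsto_one_div_add_atTop_nhds_zero_nat (𝕜 := ℝ))
        have := ((Complex.continuous_ofReal.tendsto _).comp h0).mul_const z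
        simpa using this
      · refine Filter.Eventually.of_forall fun k => ?_
        have hk : (0 : ℝ) < (k : ℝ) + 1 := by positivity
        have hk2 : 1 / ((k : ℝ) + 1) ≤ 1 := by
          rw [div_le_one hk]; linarith [(Nat.cast_nonneg k : (0 : ℝ) ≤ k)]
        have hk3 : 0 < 1 / ((k : ℝ) + 1) := by positivity
        rw [mem_closedBall_zero_iff, norm_mul, Complex.norm_real, Real.norm_eq_abs, abs_of_nonneg (by linarith)]
        nlinarith [norm_nonneg z]
    have ht2 : TendstoUniformlyOn (fun k : ℕ => h (((1 - 1 / ((k : ℝ) + 1) : ℝ) : ℂ) * z)) (h z)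
        Filter.atTop (Metric.closedBall 0 1) := by
      intro u hu
      exact hr.eventually (ht u hu)
    refine ((ht2.mono Metric.ball_subset_closedBall).tendstoLocallyUniformlyOn).differentiableOn
      (Filter.Eventually.of_forall fun k => ?_) Metric.isOpen_ball
    have hk : (0 : ℝ) < (k : ℝ) + 1 := by positivity
    have hk2 : 1 / ((k : ℝ) + 1) ≤ 1 := by
      rw [div_le_one hk]; linarith [(Nat.cast_nonneg k : (0 : ℝ) ≤ k)]
    have hk3 : 0 < 1 / ((k : ℝ) + 1) := by positivity
    have hlt : ‖((1 - 1 / ((k : ℝ) + 1) : ℝ) : ℂ) * z‖ < 1 := by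
      rw [norm_mul, Complex.norm_real, Real.norm_eq_abs, abs_of_nonneg (by linarith)]
      nlinarith [norm_nonneg z]
    exact hd.comp (f := fun w : ℂ => (((1 - 1 / ((k : ℝ) + 1) : ℝ) : ℂ) * z, w))
      (by fun_prop) (fun w hw => ⟨hlt, by simpa using hw⟩)
  · rw [closure_ball _ one_ne_zero]
    exact hc.comp (f := fun w : ℂ => (z, w)) (by fun_prop) (fun w hw => ⟨hz, by simpa using hw⟩)

theorem slice_dcc' (h : ℂ → ℂ → ℂ)
    (hd : DifferentiableOn ℂ (fun q : ℂ × ℂ => h q.1 q.2) {q : ℂ × ℂ | ‖q.1‖ < 1 ∧ ‖q.2‖ < 1})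
    (hc : ContinuousOn (fun q : ℂ × ℂ => h q.1 q.2) {q : ℂ × ℂ | ‖q.1‖ ≤ 1 ∧ ‖q.2‖ ≤ 1})
    (w : ℂ) (hw : ‖w‖ < 1) : DiffContOnCl ℂ (fun z => h z w) (Metric.ball 0 1) := by
  constructor
  · exact hd.comp (f := fun z : ℂ => (z, w)) (by fun_prop) (fun z hz => ⟨by simpa using hz, hw⟩)
  · rw [closure_ball _ one_ne_zero]
    exact hc.comp (f := fun z : ℂ => (z, w)) (by fun_prop)
      (fun z hz => ⟨by simpa using hz, hw.le⟩)

/-- Cauchy formula on the bidisk, with boundary continuity. -/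
theorem cauchy_torus (h : ℂ → ℂ → ℂ)
    (hd : DifferentiableOn ℂ (fun q : ℂ × ℂ => h q.1 q.2) {q : ℂ × ℂ | ‖q.1‖ < 1 ∧ ‖q.2‖ < 1})
    (hc : ContinuousOn (fun q : ℂ × ℂ => h q.1 q.2) {q : ℂ × ℂ | ‖q.1‖ ≤ 1 ∧ ‖q.2‖ ≤ 1})
    (a b : ℂ) (ha : ‖a‖ < 1) (hb : ‖b‖ < 1) :
    ∫ θ in (0 : ℝ)..(2 * Real.pi), ∫ φ in (0 : ℝ)..(2 * Real.pi),
      h (Complex.exp ((θ : ℂ) * Complex.I)) (Complex.exp ((φ : ℂ) * Complex.I)) /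
      (1 - star (Complex.exp ((φ : ℂ) * Complex.I)) * b) /
      (1 - star (Complex.exp ((θ : ℂ) * Complex.I)) * a) = (2 * Real.pi) ^ 2 * h a b := by
  have h1 : ∀ θ : ℝ, ∫ φ in (0 : ℝ)..(2 * Real.pi),
      h (Complex.exp ((θ : ℂ) * Complex.I)) (Complex.exp ((φ : ℂ) * Complex.I)) /
      (1 - star (Complex.exp ((φ : ℂ) * Complex.I)) * b) /
      (1 - star (Complex.exp ((θ : ℂ) * Complex.I)) * a)
      = (2 * Real.pi) * (h (Complex.exp ((θ : ℂ) * Complex.I)) b /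
      (1 - star (Complex.exp ((θ : ℂ) * Complex.I)) * a)) := by
    intro θ
    rw [intervalIntegral.integral_div, cauchy_circle _ (slice_dcc h hd hc _
      (Complex.norm_exp_ofReal_mul_I θ).le) b hb]
    ring
  simp only [h1, intervalIntegral.integral_const_mul]
  rw [cauchy_circle _ (slice_dcc' h hd hc b hb) a ha]
  ring

end helpers

section helpers2

theorem evalP_diff (n m : ℕ) (c : ℕ → ℕ → ℂ) :
    Differentiable ℂ (fun q : ℂ × ℂ => evalP n m c q.1 q.2) := by
  unfold evalP
  fun_prop

theorem evalP_cont (n m : ℕ) (c : ℕ → ℕ → ℂ) :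
    Continuous (fun q : ℂ × ℂ => evalP n m c q.1 q.2) := (evalP_diff n m c).continuous

theorem onT_cont (n m : ℕ) (c : ℕ → ℕ → ℂ) :
    Continuous (fun x : ℝ × ℝ => onT n m c x.1 x.2) := by
  unfold onT
  exact (evalP_cont n m c).comp (f := fun x : ℝ × ℝ =>
    (Complex.exp ((x.1 : ℂ) * Complex.I), Complex.exp ((x.2 : ℂ) * Complex.I))) (by fun_prop)

theorem onT_ne {n m : ℕ} {c : ℕ → ℕ → ℂ} (h : Stable n m c) (θ φ : ℝ) : onT n m c θ φ ≠ 0 :=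
  h _ _ (Complex.norm_exp_ofReal_mul_I θ).le (Complex.norm_exp_ofReal_mul_I φ).le

theorem dens_cont {n m : ℕ} {c : ℕ → ℕ → ℂ} (h : Stable n m c) :
    Continuous (fun x : ℝ × ℝ =>
      1 / ((2 * Real.pi) ^ 2 * Complex.normSq (onT n m c x.1 x.2))) := by
  have h1 := Complex.continuous_normSq.comp (onT_cont n m c)
  refine continuous_const.div (continuous_const.mul h1) fun x => ?_
  have : Complex.normSq (onT n m c x.1 x.2) ≠ 0 := by
    simpa using onT_ne h x.1 x.2
  have hpi := Real.pi_ne_zero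
  simp [hpi, onT_ne h x.1 x.2]

theorem dens_nonneg {n m : ℕ} {c : ℕ → ℕ → ℂ} (x : ℝ × ℝ) :
    0 ≤ 1 / ((2 * Real.pi) ^ 2 * Complex.normSq (onT n m c x.1 x.2)) := by
  have := Complex.normSq_nonneg (onT n m c x.1 x.2)
  positivity

theorem muT_finite {n m : ℕ} {c : ℕ → ℕ → ℂ} (h : Stable n m c) :
    IsFiniteMeasure (muT n m c) := by
  unfold muT
  refine isFiniteMeasure_withDensity_ofReal ?_
  exact ((dens_cont h).continuousOn.integrableOn_compact (isCompact_Icc.prod isCompact_Icc)).2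

theorem integral_muT {n m : ℕ} {c : ℕ → ℕ → ℂ} (h : Stable n m c) (F : ℝ × ℝ → ℂ)
    (hF : Continuous F) : ∫ x, F x ∂(muT n m c) =
    ∫ θ in (0 : ℝ)..(2 * Real.pi), ∫ φ in (0 : ℝ)..(2 * Real.pi),
      F (θ, φ) / ((2 * Real.pi) ^ 2 * (onT n m c θ φ * star (onT n m c θ φ))) := by
  have e : ∀ x : ℝ × ℝ, (ENNReal.ofReal
      (1 / ((2 * Real.pi) ^ 2 * Complex.normSq (onT n m c x.1 x.2)))).toReal • F x
      = F x / ((2 * Real.pi) ^ 2 * (onT n m c x.1 x.2 * star (onT n m c x.1 x.2))) := by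
    intro x
    rw [ENNReal.toReal_ofReal (dens_nonneg x), Complex.star_def, Complex.mul_conj, Complex.real_smul]
    push_cast
    ring
  unfold muT
  rw [integral_withDensity_eq_integral_toReal_smul
    (dens_cont h).measurable.ennreal_ofReal (by simp)]
  have hc : Continuous fun x : ℝ × ℝ => (ENNReal.ofReal
      (1 / ((2 * Real.pi) ^ 2 * Complex.normSq (onT n m c x.1 x.2)))).toReal • F x := by
    have := (dens_cont h).smul hF
    refine this.congr fun x => ?_
    rw [ENNReal.toReal_ofReal (dens_nonneg x)]
    rfl
  rw [Measure.volume_eq_prod, setIntegral_prod _ (hc.continuousOn.integrableOn_compact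
    (isCompact_Icc.prod isCompact_Icc))]
  have hpi : (0 : ℝ) ≤ 2 * Real.pi := by positivity
  rw [intervalIntegral.integral_of_le hpi, integral_Icc_eq_integral_Ioc]
  refine integral_congr_ae (Filter.Eventually.of_forall fun θ => ?_)
  simp only
  rw [intervalIntegral.integral_of_le hpi, integral_Icc_eq_integral_Ioc]
  exact integral_congr_ae (Filter.Eventually.of_forall fun φ => e (θ, φ))

theorem integral_muT_swap {n m : ℕ} {c : ℕ → ℕ → ℂ} (h : Stable n m c) (F : ℝ × ℝ → ℂ)
    (hF : Continuous F) : ∫ x, F x ∂(muT n m c) =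
    ∫ φ in (0 : ℝ)..(2 * Real.pi), ∫ θ in (0 : ℝ)..(2 * Real.pi),
      F (θ, φ) / ((2 * Real.pi) ^ 2 * (onT n m c θ φ * star (onT n m c θ φ))) := by
  rw [integral_muT h F hF]
  have hpi : (0 : ℝ) ≤ 2 * Real.pi := by positivity
  simp only [intervalIntegral.integral_of_le hpi]
  refine integral_integral_swap ?_
  have hc : Continuous (Function.uncurry fun θ φ : ℝ =>
      F (θ, φ) / ((2 * Real.pi) ^ 2 * (onT n m c θ φ * star (onT n m c θ φ)))) := by
    have h1 := onT_cont n m c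
    refine hF.div (continuous_const.mul (h1.mul h1.star)) fun x => ?_
    have hpi : (Real.pi : ℂ) ≠ 0 := by exact_mod_cast Real.pi_ne_zero
    simp [hpi, onT_ne h x.1 x.2]
  have hi := hc.continuousOn.integrableOn_compact (μ := volume.prod volume)
    (isCompact_uIcc (a := (0 : ℝ)) (b := 2 * Real.pi) |>.prod
    (isCompact_uIcc (a := (0 : ℝ)) (b := 2 * Real.pi)))
  rw [Measure.prod_restrict]
  have hsub : Set.Ioc 0 (2 * Real.pi) ⊆ Set.uIcc 0 (2 * Real.pi) := by
    rw [Set.uIcc_of_le hpi]; exact Set.Ioc_subset_Icc_self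
  exact hi.mono_set (Set.prod_mono hsub hsub)

theorem one_sub_ne {z s : ℂ} (hz : ‖z‖ ≤ 1) (hs : ‖s‖ < 1) : 1 - z * s ≠ 0 := by
  intro h0
  have h1 : z * s = 1 := (sub_eq_zero.1 h0).symm
  have h2 : ‖z‖ * ‖s‖ = 1 := by rw [← norm_mul, h1, norm_one]
  nlinarith [norm_nonneg z, norm_nonneg s]

theorem exp_star (θ : ℝ) : Complex.exp ((θ : ℂ) * Complex.I) *
    star (Complex.exp ((θ : ℂ) * Complex.I)) = 1 := by
  rw [Complex.star_def, Complex.mul_conj, Complex.normSq_eq_norm_sq, Complex.norm_exp_ofReal_mul_I]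
  simp

theorem tmono_eq (i j : ℕ) (θ φ : ℝ) : tmono i j θ φ =
    Complex.exp ((θ : ℂ) * Complex.I) ^ i * Complex.exp ((φ : ℂ) * Complex.I) ^ j := by
  unfold tmono
  rw [← Complex.exp_nat_mul, ← Complex.exp_nat_mul, ← Complex.exp_add]
  congr 1
  push_cast
  ring

/-- one-variable vanishing -/
theorem vanish (q : ℂ → ℂ) (hq : Differentiable ℂ q) (hq0 : ∀ w, ‖w‖ ≤ 1 → q w ≠ 0) (t C : ℂ)
    (ht : ‖t‖ < 1) (k : ℕ) (hk : k ≠ 0) :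
    ∫ φ in (0 : ℝ)..(2 * Real.pi), C * (Complex.exp ((φ : ℂ) * Complex.I) ^ k /
      (q (Complex.exp ((φ : ℂ) * Complex.I)) * (1 - Complex.exp ((φ : ℂ) * Complex.I) * t))) = 0 := by
  have hd : DiffContOnCl ℂ (fun w : ℂ => C * (w ^ k / (q w * (1 - w * t)))) (Metric.ball 0 1) := by
    apply DifferentiableOn.diffContOnCl
    rw [closure_ball _ one_ne_zero]
    refine (DifferentiableOn.div (by fun_prop) (by fun_prop) fun w hw => ?_).const_mul C
    have hw' : ‖w‖ ≤ 1 := by simpa using hw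
    exact mul_ne_zero (hq0 w hw') (one_sub_ne hw' ht)
  have := cauchy_circle _ hd 0 (by simp)
  simpa [hk] using this

theorem pow_star {z : ℂ} (hz : z * star z = 1) {i n : ℕ} (h : i ≤ n) :
    z ^ n * star z ^ i = z ^ (n - i) := by
  conv_lhs => rw [← Nat.sub_add_cancel h, pow_add, mul_assoc, ← mul_pow, hz]
  simp

theorem orth {n m : ℕ} {c : ℕ → ℕ → ℂ} (h : Stable n m c) (s t : ℂ) (hs : ‖s‖ < 1) (ht : ‖t‖ < 1)
    (i j : ℕ) (hij : i < n ∨ j < m) :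
    ∫ x : ℝ × ℝ, star (tmono i j x.1 x.2) * (onT n m (reflC n m c) x.1 x.2 /
      ((1 - Complex.exp ((x.1 : ℂ) * Complex.I) * s) *
        (1 - Complex.exp ((x.2 : ℂ) * Complex.I) * t))) ∂(muT n m c) = 0 := by
  have hpi : (Real.pi : ℂ) ≠ 0 := by exact_mod_cast Real.pi_ne_zero
  have hcont : Continuous fun x : ℝ × ℝ =>
      star (tmono i j x.1 x.2) * (onT n m (reflC n m c) x.1 x.2 /
      ((1 - Complex.exp ((x.1 : ℂ) * Complex.I) * s) *
        (1 - Complex.exp ((x.2 : ℂ) * Complex.I) * t))) := by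
    refine Continuous.mul ?_ (Continuous.div (onT_cont _ _ _) (by fun_prop) fun x => ?_)
    · unfold tmono
      refine Continuous.star ?_
      fun_prop
    · exact mul_ne_zero (one_sub_ne (Complex.norm_exp_ofReal_mul_I _).le hs)
        (one_sub_ne (Complex.norm_exp_ofReal_mul_I _).le ht)
  have key : ∀ θ φ : ℝ, star (tmono i j θ φ) * (onT n m (reflC n m c) θ φ /
      ((1 - Complex.exp ((θ : ℂ) * Complex.I) * s) *
        (1 - Complex.exp ((φ : ℂ) * Complex.I) * t)))
        / ((2 * Real.pi) ^ 2 * (onT n m c θ φ * star (onT n m c θ φ)))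
      = ((Complex.exp ((θ : ℂ) * Complex.I)) ^ n * star (Complex.exp ((θ : ℂ) * Complex.I)) ^ i)
        * ((Complex.exp ((φ : ℂ) * Complex.I)) ^ m * star (Complex.exp ((φ : ℂ) * Complex.I)) ^ j)
        / ((2 * Real.pi) ^ 2 * onT n m c θ φ * ((1 - Complex.exp ((θ : ℂ) * Complex.I) * s) *
        (1 - Complex.exp ((φ : ℂ) * Complex.I) * t))) := by
    intro θ φ
    have h0 := onT_ne h θ φ
    have h0' : star (onT n m c θ φ) ≠ 0 := star_ne_zero.2 h0
    have h1 := one_sub_ne (Complex.norm_exp_ofReal_mul_I θ).le hs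
    have h2 := one_sub_ne (Complex.norm_exp_ofReal_mul_I φ).le ht
    have e : onT n m (reflC n m c) θ φ = Complex.exp ((θ : ℂ) * Complex.I) ^ n *
      Complex.exp ((φ : ℂ) * Complex.I) ^ m * star (onT n m c θ φ) :=
      evalP_refl_torus _ _ _ _ _ (exp_star θ) (exp_star φ)
    rw [e, tmono_eq, star_mul', star_pow, star_pow]
    field_simp
  have hz := fun θ : ℝ => (Complex.norm_exp_ofReal_mul_I θ).le
  rcases hij with hi | hj
  · rw [integral_muT_swap h _ hcont]
    simp_rw [key]
    rw [show (0 : ℂ) = ∫ φ in (0 : ℝ)..(2 * Real.pi), (0 : ℂ) by simp]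
    refine intervalIntegral.integral_congr fun φ _ => ?_
    rw [← vanish (fun z => evalP n m c z (Complex.exp ((φ : ℂ) * Complex.I)))
      ((evalP_diff n m c).comp (f := fun z : ℂ => (z, Complex.exp ((φ : ℂ) * Complex.I)))
        (by fun_prop)) (fun z hz' => h _ _ hz' (hz φ)) s
      (((Complex.exp ((φ : ℂ) * Complex.I)) ^ m * star (Complex.exp ((φ : ℂ) * Complex.I)) ^ j) /
        ((2 * Real.pi) ^ 2 * (1 - Complex.exp ((φ : ℂ) * Complex.I) * t))) hs (n - i) (by omega)]
    refine intervalIntegral.integral_congr fun θ _ => ?_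
    rw [pow_star (exp_star θ) hi.le, div_mul_div_comm]
    unfold onT
    congr 1 <;> ring
  · rw [integral_muT h _ hcont]
    simp_rw [key]
    rw [show (0 : ℂ) = ∫ θ in (0 : ℝ)..(2 * Real.pi), (0 : ℂ) by simp]
    refine intervalIntegral.integral_congr fun θ _ => ?_
    rw [← vanish (fun w => evalP n m c (Complex.exp ((θ : ℂ) * Complex.I)) w)
      ((evalP_diff n m c).comp (f := fun w : ℂ => (Complex.exp ((θ : ℂ) * Complex.I), w))
        (by fun_prop)) (fun w hw' => h _ _ (hz θ) hw') t
      (((Complex.exp ((θ : ℂ) * Complex.I)) ^ n * star (Complex.exp ((θ : ℂ) * Complex.I)) ^ i) /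
        ((2 * Real.pi) ^ 2 * (1 - Complex.exp ((θ : ℂ) * Complex.I) * s))) ht (m - j) (by omega)]
    refine intervalIntegral.integral_congr fun φ _ => ?_
    rw [pow_star (exp_star φ) hj.le, div_mul_div_comm]
    unfold onT
    congr 1 <;> ring

theorem repro {n m : ℕ} {c : ℕ → ℕ → ℂ} (h : Stable n m c) (z₁ w₁ : ℂ) (hz : ‖z₁‖ < 1)
    (hw : ‖w₁‖ < 1) (g : ℂ → ℂ → ℂ)
    (hd : DifferentiableOn ℂ (fun q : ℂ × ℂ => g q.1 q.2) {q : ℂ × ℂ | ‖q.1‖ < 1 ∧ ‖q.2‖ < 1})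
    (hc : ContinuousOn (fun q : ℂ × ℂ => g q.1 q.2) {q : ℂ × ℂ | ‖q.1‖ ≤ 1 ∧ ‖q.2‖ ≤ 1}) :
    ∫ x : ℝ × ℝ, star (onT n m c x.1 x.2 /
      ((1 - Complex.exp ((x.1 : ℂ) * Complex.I) * star z₁) *
        (1 - Complex.exp ((x.2 : ℂ) * Complex.I) * star w₁))) *
        g (Complex.exp ((x.1 : ℂ) * Complex.I)) (Complex.exp ((x.2 : ℂ) * Complex.I)) ∂(muT n m c)
      = g z₁ w₁ / evalP n m c z₁ w₁ := by
  have hpi : (Real.pi : ℂ) ≠ 0 := by exact_mod_cast Real.pi_ne_zero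
  have hs : ‖star z₁‖ < 1 := by rwa [norm_star]
  have ht : ‖star w₁‖ < 1 := by rwa [norm_star]
  have hu := fun θ : ℝ => (Complex.norm_exp_ofReal_mul_I θ).le
  rw [integral_muT h]
  · have hd' : DifferentiableOn ℂ (fun q : ℂ × ℂ => g q.1 q.2 / evalP n m c q.1 q.2)
        {q : ℂ × ℂ | ‖q.1‖ < 1 ∧ ‖q.2‖ < 1} := by
      have hi : DifferentiableOn ℂ (fun q : ℂ × ℂ => (evalP n m c q.1 q.2)⁻¹)
          {q : ℂ × ℂ | ‖q.1‖ < 1 ∧ ‖q.2‖ < 1} :=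
        DifferentiableOn.inv (evalP_diff n m c).differentiableOn
          (fun q hq => h _ _ hq.1.le hq.2.le)
      simp only [div_eq_mul_inv]
      exact hd.mul hi
    have hc' : ContinuousOn (fun q : ℂ × ℂ => g q.1 q.2 / evalP n m c q.1 q.2)
        {q : ℂ × ℂ | ‖q.1‖ ≤ 1 ∧ ‖q.2‖ ≤ 1} :=
      hc.div (evalP_cont n m c).continuousOn (fun q hq => h _ _ hq.1 hq.2)
    have hC := cauchy_torus (fun z w => g z w / evalP n m c z w) hd' hc' z₁ w₁ hz hw
    have : g z₁ w₁ / evalP n m c z₁ w₁ =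
        (1 / (2 * Real.pi) ^ 2) * ((2 * Real.pi) ^ 2 * (g z₁ w₁ / evalP n m c z₁ w₁)) := by
      field_simp
    rw [this, ← hC, ← intervalIntegral.integral_const_mul]
    refine intervalIntegral.integral_congr fun θ _ => ?_
    simp only
    rw [← intervalIntegral.integral_const_mul]
    refine intervalIntegral.integral_congr fun φ _ => ?_
    have h0 := onT_ne h θ φ
    have h0' : star (onT n m c θ φ) ≠ 0 := star_ne_zero.2 h0
    have h1 : 1 - star (Complex.exp ((θ : ℂ) * Complex.I)) * z₁ ≠ 0 :=
      one_sub_ne (by rw [norm_star]; exact hu θ) hz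
    have h2 : 1 - star (Complex.exp ((φ : ℂ) * Complex.I)) * w₁ ≠ 0 :=
      one_sub_ne (by rw [norm_star]; exact hu φ) hw
    rw [star_div₀, star_mul', star_sub, star_sub, star_mul', star_mul', star_star, star_star,
      star_one]
    change _ = 1 / (2 * (Real.pi : ℂ)) ^ 2 * (_ / onT n m c θ φ / _ / _)
    field_simp
  · refine Continuous.mul (Continuous.star (Continuous.div (onT_cont _ _ _) (by fun_prop)
      fun x => ?_)) ?_
    · exact mul_ne_zero (one_sub_ne (hu _) hs) (one_sub_ne (hu _) ht)
    · exact hc.comp_continuous (f := fun x : ℝ × ℝ =>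
        (Complex.exp ((x.1 : ℂ) * Complex.I), Complex.exp ((x.2 : ℂ) * Complex.I)))
        (by fun_prop) (fun x => ⟨hu _, hu _⟩)

end helpers2

section helpers3
open BoundedContinuousFunction

/-- the coordinate function `z` on the torus as a bounded continuous function -/
noncomputable def bz : BoundedContinuousFunction (ℝ × ℝ) ℂ :=
  BoundedContinuousFunction.ofNormedAddCommGroup
    (fun q : ℝ × ℝ => Complex.exp ((q.1 : ℂ) * Complex.I)) (by fun_prop) 1
    (fun q => (Complex.norm_exp_ofReal_mul_I _).le)

/-- the coordinate function `w` on the torus as a bounded continuous function -/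
noncomputable def bw : BoundedContinuousFunction (ℝ × ℝ) ℂ :=
  BoundedContinuousFunction.ofNormedAddCommGroup
    (fun q : ℝ × ℝ => Complex.exp ((q.2 : ℂ) * Complex.I)) (by fun_prop) 1
    (fun q => (Complex.norm_exp_ofReal_mul_I _).le)

theorem bz_apply (q : ℝ × ℝ) : bz q = Complex.exp ((q.1 : ℂ) * Complex.I) := rfl
theorem bw_apply (q : ℝ × ℝ) : bw q = Complex.exp ((q.2 : ℂ) * Complex.I) := rfl

theorem smul_bz_lt (s : ℂ) (hs : ‖s‖ < 1) : ‖s • bz‖ < 1 := by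
  have h : ‖bz‖ ≤ 1 := BoundedContinuousFunction.norm_ofNormedAddCommGroup_le _ zero_le_one _
  rw [norm_smul]
  nlinarith [norm_nonneg s, norm_nonneg bz]

theorem smul_bw_lt (s : ℂ) (hs : ‖s‖ < 1) : ‖s • bw‖ < 1 := by
  have h : ‖bw‖ ≤ 1 := BoundedContinuousFunction.norm_ofNormedAddCommGroup_le _ zero_le_one _
  rw [norm_smul]
  nlinarith [norm_nonneg s, norm_nonneg bw]

/-- polynomial with coefficients `N` divided by `(1 - z s)(1 - w t)` -/
noncomputable def bK (n m : ℕ) (N : ℕ → ℕ → ℂ) (s t : ℂ) :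
    BoundedContinuousFunction (ℝ × ℝ) ℂ :=
  (∑ a ∈ Finset.range (n + 1), ∑ b ∈ Finset.range (m + 1), N a b • (bz ^ a * bw ^ b)) *
    (∑' k : ℕ, (s • bz) ^ k) * (∑' k : ℕ, (t • bw) ^ k)

theorem bK_apply (n m : ℕ) (N : ℕ → ℕ → ℂ) (s t : ℂ) (hs : ‖s‖ < 1) (ht : ‖t‖ < 1)
    (q : ℝ × ℝ) : bK n m N s t q = onT n m N q.1 q.2 /
      ((1 - Complex.exp ((q.1 : ℂ) * Complex.I) * s) *
        (1 - Complex.exp ((q.2 : ℂ) * Complex.I) * t)) := by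
  have h1 := congrArg (fun f : BoundedContinuousFunction (ℝ × ℝ) ℂ => f q)
    (geom_series_mul_neg (s • bz) (smul_bz_lt s hs))
  have h2 := congrArg (fun f : BoundedContinuousFunction (ℝ × ℝ) ℂ => f q)
    (geom_series_mul_neg (t • bw) (smul_bw_lt t ht))
  unfold bK
  set Z := ∑' k : ℕ, (s • bz) ^ k
  set W := ∑' k : ℕ, (t • bw) ^ k
  simp only [BoundedContinuousFunction.coe_mul, BoundedContinuousFunction.coe_sub, Pi.mul_apply,
    Pi.sub_apply, BoundedContinuousFunction.coe_one, Pi.one_apply,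
    BoundedContinuousFunction.coe_smul, smul_eq_mul, bz_apply, bw_apply] at h1 h2
  have d1 := one_sub_ne (Complex.norm_exp_ofReal_mul_I q.1).le hs
  have d2 := one_sub_ne (Complex.norm_exp_ofReal_mul_I q.2).le ht
  have e : (∑ a ∈ Finset.range (n + 1), ∑ b ∈ Finset.range (m + 1),
      N a b • (bz ^ a * bw ^ b)) q = onT n m N q.1 q.2 := by
    unfold onT evalP
    simp [BoundedContinuousFunction.coe_sum, bz_apply, bw_apply, mul_assoc]
  rw [BoundedContinuousFunction.coe_mul, Pi.mul_apply, BoundedContinuousFunction.coe_mul,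
    Pi.mul_apply, e, eq_div_iff (mul_ne_zero d1 d2)]
  linear_combination onT n m N q.1 q.2 * (W q * (1 - t * Complex.exp ((q.2 : ℂ) * Complex.I))) * h1
    + onT n m N q.1 q.2 * h2

theorem toLp_eq_of_ae {μ : Measure (ℝ × ℝ)} [IsFiniteMeasure μ] (F : BoundedContinuousFunction (ℝ × ℝ) ℂ)
    (f : Lp ℂ 2 μ) (h : (f : ℝ × ℝ → ℂ) =ᵐ[μ] F) :
    BoundedContinuousFunction.toLp 2 μ ℂ F = f :=
  Lp.ext ((BoundedContinuousFunction.coeFn_toLp 2 μ ℂ F).trans h.symm)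

end helpers3

/-- the above kernel is the reproducing kernel of the closed span of
{z^i w^j : i,j ≥ 0, i < n or j < m} in L²(dσ/|p|²). -/
theorem statement16 (n m : ℕ) (c : ℕ → ℕ → ℂ)
    (hstable : Stable n m c) (hdeg : DegreeNM n m c)
    (M : ℤ → ℤ → Lp ℂ 2 (muT n m c))
    (hM : ∀ i j : ℤ, (M i j : ℝ × ℝ → ℂ) =ᵐ[muT n m c] fun x => tmono i j x.1 x.2)
    (K : ℂ → ℂ → Lp ℂ 2 (muT n m c))
    (hK : ∀ z₁ w₁ : ℂ, ‖z₁‖ < 1 → ‖w₁‖ < 1 →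
      (K z₁ w₁ : ℝ × ℝ → ℂ) =ᵐ[muT n m c] KHfun n m c z₁ w₁) :
    ∀ z₁ w₁ : ℂ, ‖z₁‖ < 1 → ‖w₁‖ < 1 →
      K z₁ w₁ ∈ (Submodule.span ℂ
          {f | ∃ i j : ℕ, (i < n ∨ j < m) ∧ f = M (i : ℤ) (j : ℤ)}).topologicalClosure
      ∧ ∀ f ∈ (Submodule.span ℂ
            {f | ∃ i j : ℕ, (i < n ∨ j < m) ∧ f = M (i : ℤ) (j : ℤ)}).topologicalClosure,
          ∀ g : ℂ → ℂ → ℂ,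
            DifferentiableOn ℂ (fun q : ℂ × ℂ => g q.1 q.2)
              {q : ℂ × ℂ | ‖q.1‖ < 1 ∧ ‖q.2‖ < 1} →
            ContinuousOn (fun q : ℂ × ℂ => g q.1 q.2)
              {q : ℂ × ℂ | ‖q.1‖ ≤ 1 ∧ ‖q.2‖ ≤ 1} →
            ((f : ℝ × ℝ → ℂ) =ᵐ[muT n m c] fun x =>
              g (Complex.exp ((x.1 : ℂ) * Complex.I))
                (Complex.exp ((x.2 : ℂ) * Complex.I))) →
            ⟪K z₁ w₁, f⟫ = g z₁ w₁ := by
  intro z₁ w₁ hz hw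
  haveI := muT_finite hstable
  set S := {f | ∃ i j : ℕ, (i < n ∨ j < m) ∧ f = M (i : ℤ) (j : ℤ)} with hS
  set H := (Submodule.span ℂ S).topologicalClosure with hH
  have hs : ‖star z₁‖ < 1 := by rwa [norm_star]
  have ht : ‖star w₁‖ < 1 := by rwa [norm_star]
  let T := BoundedContinuousFunction.toLp (α := ℝ × ℝ) (E := ℂ) 2 (muT n m c) ℂ
  let N : ℕ → ℕ → ℂ := fun a b => star (evalP n m c z₁ w₁) * c a b
    - star (evalP n m (reflC n m c) z₁ w₁) * reflC n m c a b
  have hTM : ∀ i j : ℕ, T (bz ^ i * bw ^ j) = M i j := by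
    intro i j
    refine toLp_eq_of_ae _ _ ((hM i j).trans (Filter.Eventually.of_forall fun q => ?_))
    simp [tmono_eq, bz_apply, bw_apply]
  have hlin : bK n m N (star z₁) (star w₁) =
      star (evalP n m c z₁ w₁) • bK n m c (star z₁) (star w₁)
      - star (evalP n m (reflC n m c) z₁ w₁) • bK n m (reflC n m c) (star z₁) (star w₁) := by
    unfold bK
    simp only [N, sub_smul, Finset.sum_sub_distrib, sub_mul, mul_smul, ← Finset.smul_sum,
      smul_mul_assoc]
  have hTK : T (bK n m N (star z₁) (star w₁)) = K z₁ w₁ := by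
    refine toLp_eq_of_ae _ _ ((hK z₁ w₁ hz hw).trans (Filter.Eventually.of_forall fun q => ?_))
    rw [hlin]
    simp only [BoundedContinuousFunction.coe_sub, Pi.sub_apply,
      BoundedContinuousFunction.coe_smul, smul_eq_mul, bK_apply _ _ _ _ _ hs ht, KHfun]
    ring
  constructor
  · rw [← hTK]
    let V : Submodule ℂ (BoundedContinuousFunction (ℝ × ℝ) ℂ) := H.comap T.toLinearMap
    have hV : IsClosed (V : Set (BoundedContinuousFunction (ℝ × ℝ) ℂ)) :=
      (Submodule.isClosed_topologicalClosure _).preimage T.continuous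
    have hmon : ∀ i j : ℕ, (i < n ∨ j < m) → bz ^ i * bw ^ j ∈ V := by
      intro i j hij
      change T (bz ^ i * bw ^ j) ∈ H
      rw [hTM]
      exact Submodule.le_topologicalClosure _ (Submodule.subset_span ⟨i, j, hij, rfl⟩)
    change bK n m N (star z₁) (star w₁) ∈ V
    refine mem_alg V n m (star z₁) (star w₁) bz bw _ _
      (geom_series_mul_neg _ (smul_bz_lt _ hs)) (geom_series_mul_neg _ (smul_bw_lt _ ht))
      (fun i b hi => geom_mem V hV _ _ _ (smul_bw_lt _ ht) b fun k => hmon i k (Or.inl hi))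
      (fun j b hj => geom_mem V hV _ _ _ (smul_bz_lt _ hs) b fun k => ?_) N ?_
    · rw [mul_comm]
      exact hmon k j (Or.inr hj)
    · have e1 := sum_refl n m c z₁ w₁
      have e2 := sum_refl n m (reflC n m c) z₁ w₁
      rw [evalP_refl_refl] at e2
      simp only [N, sub_mul, Finset.sum_sub_distrib, mul_assoc, ← Finset.mul_sum]
      simp only [mul_assoc] at e1 e2
      rw [e1, e2]
      ring
  · intro f hf g hd hc hfg
    have horth : ⟪T (bK n m (reflC n m c) (star z₁) (star w₁)), f⟫ = 0 := by
      have hle : H ≤ (ℂ ∙ T (bK n m (reflC n m c) (star z₁) (star w₁)))ᗮ := by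
        refine Submodule.topologicalClosure_minimal _ (Submodule.span_le.2 ?_)
          (Submodule.isClosed_orthogonal _)
        rintro _ ⟨i, j, hij, rfl⟩
        rw [SetLike.mem_coe, Submodule.mem_orthogonal_singleton_iff_inner_left, L2.inner_def,
          ← orth hstable (star z₁) (star w₁) hs ht i j hij]
        refine integral_congr_ae ?_
        filter_upwards [hM i j, BoundedContinuousFunction.coeFn_toLp 2 (muT n m c) ℂ
          (bK n m (reflC n m c) (star z₁) (star w₁))] with q h1 h2
        rw [h1, h2, bK_apply _ _ _ _ _ hs ht, RCLike.inner_apply, mul_comm]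
        rfl
      exact Submodule.mem_orthogonal_singleton_iff_inner_right.1 (hle hf)
    have hrep : ⟪T (bK n m c (star z₁) (star w₁)), f⟫ = g z₁ w₁ / evalP n m c z₁ w₁ := by
      rw [L2.inner_def, ← repro hstable z₁ w₁ hz hw g hd hc]
      refine integral_congr_ae ?_
      filter_upwards [hfg, BoundedContinuousFunction.coeFn_toLp 2 (muT n m c) ℂ
          (bK n m c (star z₁) (star w₁))] with q h1 h2
      rw [h1, h2, bK_apply _ _ _ _ _ hs ht, RCLike.inner_apply, mul_comm]
      rfl
    have hp := hstable z₁ w₁ hz.le hw.le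
    rw [← hTK, hlin, map_sub, map_smul, map_smul, inner_sub_left, inner_smul_left,
      inner_smul_left, horth, hrep]
    simp only [Complex.star_def, Complex.conj_conj, mul_zero, sub_zero]
    field_simp
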